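/- There exist constants C > 0, K > 0 and n₀ such that the following holds. Let G be a graph on n ≥ n₀ vertices with average degree d, minimum degree δ, maximum degree Δ, and suppose λ̄ > 0 is such that for all vertex subsets U, W we have |e(U,W) − (d/n)·|U|·|W|| ≤ λ̄·√(|U|·|W|), that Δ − δ ≤ λ̄, that d ≥ K·λ̄·(log n)², and that (log d)·log(d/λ̄) ≥ K·log n. Then for every path P in G there exists a path P* in G with endpoints a and b such that: (1) P* has the same vertex set as P; (2) the symmetric difference of the edge sets of P and P* has size at most C·log n / log(d/λ̄); and (3) either ab is an edge of G, or G contains an edge between {a, b} and the set of vertices outside P*. -/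

import Mathlib

open SimpleGraph

/-- The degree of a vertex. -/
noncomputable def degOf {n : ℕ} (G : SimpleGraph (Fin n)) (v : Fin n) : ℕ :=
  (G.neighborSet v).ncard

/-- The average degree of `G`. -/
noncomputable def avgDeg {n : ℕ} (G : SimpleGraph (Fin n)) : ℝ :=
  (∑ v : Fin n, (degOf G v : ℝ)) / n

/-- `e(U,W)`: the number of ordered pairs `(u,w)`, `u ∈ U`, `w ∈ W`, `uw ∈ E(G)`. -/
noncomputable def ePairs {n : ℕ} (G : SimpleGraph (Fin n)) (U W : Set (Fin n)) : ℕ :=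
  {p : Fin n × Fin n | p.1 ∈ U ∧ p.2 ∈ W ∧ G.Adj p.1 p.2}.ncard

/-- The minimum degree of `G`. -/
noncomputable def minDeg {n : ℕ} (G : SimpleGraph (Fin n)) : ℕ := sInf (Set.range (degOf G))

/-- The maximum degree of `G`. -/
noncomputable def maxDeg {n : ℕ} (G : SimpleGraph (Fin n)) : ℕ := sSup (Set.range (degOf G))

/-- The edges `s(xᵢ, xᵢ₊₁)` joining consecutive entries of a list. -/
def pathEdges {V : Type*} [DecidableEq V] : List V → Finset (Sym2 V)
  | [] => ∅
  | [_] => ∅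
  | x :: y :: l => insert s(x, y) (pathEdges (y :: l))

section PathLists

variable {V : Type*} [DecidableEq V]

lemma mem_of_mem_pathEdges {x y : V} : ∀ {L : List V}, s(x, y) ∈ pathEdges L → x ∈ L ∧ y ∈ L
  | [], h => by simp [pathEdges] at h
  | [_], h => by simp [pathEdges] at h
  | a :: b :: l, h => by
    simp only [pathEdges, Finset.mem_insert] at h
    rcases h with h | h
    · simp only [Sym2.eq_iff] at h
      rcases h with ⟨rfl, rfl⟩ | ⟨rfl, rfl⟩ <;> simp
    · have := mem_of_mem_pathEdges h
      exact ⟨List.mem_cons_of_mem _ this.1, List.mem_cons_of_mem _ this.2⟩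

lemma pathEdges_append {c e : V} : ∀ {X Y : List V}, X.getLast? = some c → Y.head? = some e →
    pathEdges (X ++ Y) = insert s(c, e) (pathEdges X ∪ pathEdges Y)
  | [], _, h, _ => by simp at h
  | [a], [], _, h => by simp at h
  | [a], b :: l, h, h' => by
    simp only [List.getLast?_singleton, Option.some.injEq] at h
    simp only [List.head?_cons, Option.some.injEq] at h'
    subst h h'
    simp [pathEdges]
  | a :: b :: l, Y, h, h' => by
    have := pathEdges_append (X := b :: l) (Y := Y) (by simpa using h) h'
    simp only [List.cons_append, pathEdges] at this ⊢
    rw [this]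
    ext z
    simp only [Finset.mem_insert, Finset.mem_union]
    tauto

lemma pathEdges_reverse : ∀ L : List V, pathEdges L.reverse = pathEdges L
  | [] => rfl
  | [_] => rfl
  | a :: b :: l => by
    rw [List.reverse_cons, pathEdges_append (c := b) (e := a) (by simp) (by simp),
      pathEdges_reverse (b :: l)]
    simp [pathEdges, Sym2.eq_swap]

lemma getLast?_eq_or_head?_eq_of_mem_pathEdges {x u : V} {A B : List V}
    (hnd : (A ++ x :: B).Nodup) (h : s(x, u) ∈ pathEdges (A ++ x :: B)) :
    A.getLast? = some u ∨ B.head? = some u := by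
  have hA : x ∉ A := fun hx => by
    have := List.disjoint_of_nodup_append hnd hx
    simp at this
  have hB : x ∉ B := (List.nodup_cons.1 (hnd.of_append_right)).1
  have key : s(x, u) ∈ pathEdges (x :: B) → B.head? = some u := by
    intro h
    cases B with
    | nil => simp [pathEdges] at h
    | cons b l =>
      simp only [pathEdges, Finset.mem_insert] at h
      rcases h with h | h
      · simp only [Sym2.eq_iff] at h
        simp only [List.head?_cons, Option.some.injEq]
        rcases h with ⟨_, h⟩ | ⟨h1, h2⟩
        · exact h.symm
        · rw [← h1, h2]
      · exact absurd (mem_of_mem_pathEdges h).1 hB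
  cases hc : A.getLast? with
  | none =>
    rw [List.getLast?_eq_none_iff] at hc
    subst hc
    exact Or.inr (key h)
  | some c =>
    rw [pathEdges_append hc (by simp : (x :: B).head? = some x)] at h
    simp only [Finset.mem_insert, Finset.mem_union] at h
    rcases h with h | h | h
    · left
      simp only [Sym2.eq_iff] at h
      rcases h with ⟨h1, h2⟩ | ⟨_, h⟩
      · rw [← h1, h2]
      · rw [h]
    · exact absurd (mem_of_mem_pathEdges h).1 hA
    · exact Or.inr (key h)

/-- The neighbours of `y` along the list `L`. -/
def pathNbrs [Fintype V] (L : List V) (y : V) : Finset V :=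
  Finset.univ.filter fun x => s(y, x) ∈ pathEdges L

lemma card_pathNbrs_le [Fintype V] {L : List V} (hL : L.Nodup) (y : V) :
    (pathNbrs L y).card ≤ 2 := by
  by_cases hy : y ∈ L
  · obtain ⟨A, B, rfl⟩ := List.append_of_mem hy
    have : pathNbrs (A ++ y :: B) y ⊆ A.getLast?.toFinset ∪ B.head?.toFinset := by
      intro x hx
      simp only [pathNbrs, Finset.mem_filter, Finset.mem_univ, true_and] at hx
      have := getLast?_eq_or_head?_eq_of_mem_pathEdges hL hx
      simpa [Finset.mem_union, Option.mem_toFinset] using this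
    refine (Finset.card_le_card this).trans ((Finset.card_union_le _ _).trans ?_)
    have h1 : ∀ o : Option V, o.toFinset.card ≤ 1 := by
      intro o; cases o <;> simp
    have := h1 A.getLast?
    have := h1 B.head?
    omega
  · have : pathNbrs L y = ∅ := by
      ext x
      simp only [pathNbrs, Finset.mem_filter, Finset.mem_univ, true_and, Finset.notMem_empty,
        iff_false]
      exact fun h => hy (mem_of_mem_pathEdges h).1
    simp [this]

lemma card_biUnion_pathNbrs_le [Fintype V] {L : List V} (hL : L.Nodup) (A : Finset V) :
    (A.biUnion (pathNbrs L)).card ≤ A.card * 2 :=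
  Finset.card_biUnion_le_card_mul _ _ _ fun y _ => card_pathNbrs_le hL y

/-- `L` is a path of `G` on the vertices of `Q`, with the same last vertex, which differs from `Q`
in at most `c` edges. -/
structure Reroutes (G : SimpleGraph V) (Q L : List V) (c : ℕ) : Prop where
  perm : L.Perm Q
  chain : L.IsChain G.Adj
  last : L.getLast? = Q.getLast?
  card_le : (symmDiff (pathEdges Q) (pathEdges L)).card ≤ c

lemma Reroutes.refl {G : SimpleGraph V} {Q : List V} (h : Q.IsChain G.Adj) : Reroutes G Q Q 0 :=
  ⟨List.Perm.refl _, h, rfl, by simp⟩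

lemma card_symmDiff_le_add {α : Type*} [DecidableEq α] (A B C : Finset α) :
    (symmDiff A C).card ≤ (symmDiff A B).card + (symmDiff B C).card := by
  refine (Finset.card_le_card ?_).trans (Finset.card_union_le _ _)
  intro x
  simp only [Finset.mem_union, Finset.mem_symmDiff]
  tauto

lemma Reroutes.trans {G : SimpleGraph V} {P Q L : List V} {c c' : ℕ} (h : Reroutes G P Q c)
    (h' : Reroutes G Q L c') : Reroutes G P L (c + c') :=
  ⟨h'.perm.trans h.perm, h'.chain, h'.last.trans h.last,
    (card_symmDiff_le_add _ (pathEdges Q) _).trans (add_le_add h.card_le h'.card_le)⟩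

lemma Reroutes.mono {G : SimpleGraph V} {P Q : List V} {c c' : ℕ} (h : Reroutes G P Q c)
    (hc : c ≤ c') : Reroutes G P Q c' :=
  ⟨h.perm, h.chain, h.last, h.card_le.trans hc⟩

lemma isChain_reverse_iff {α : Type*} {G : SimpleGraph α} {L : List α} :
    L.reverse.IsChain G.Adj ↔ L.IsChain G.Adj := by
  rw [List.isChain_reverse]
  simp only [G.adj_comm]

/-- A Pósa rotation: if the first vertex `v` of `A ++ x :: B` is adjacent to `x`, the initial
segment `A` may be reversed. -/
lemma rotate {G : SimpleGraph V} {A B : List V} {v x y : V}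
    (hchain : (A ++ x :: B).IsChain G.Adj) (hv : A.head? = some v) (hy : A.getLast? = some y)
    (hadj : G.Adj v x) :
    Reroutes G (A ++ x :: B) (A.reverse ++ x :: B) 2 ∧
      ∀ e ∈ pathEdges (A ++ x :: B), e ∉ pathEdges (A.reverse ++ x :: B) → e = s(y, x) := by
  have e1 : pathEdges (A ++ x :: B) = insert s(y, x) (pathEdges A ∪ pathEdges (x :: B)) :=
    pathEdges_append hy (by simp)
  have e2 : pathEdges (A.reverse ++ x :: B) =
      insert s(v, x) (pathEdges A ∪ pathEdges (x :: B)) := by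
    rw [pathEdges_append (c := v) (e := x) (by simpa using hv) (by simp), pathEdges_reverse]
  refine ⟨⟨?_, ?_, by rw [List.getLast?_append_of_ne_nil _ (by simp),
    List.getLast?_append_of_ne_nil _ (by simp)], ?_⟩, ?_⟩
  · exact List.Perm.append_right _ (List.reverse_perm _)
  · rw [List.isChain_append] at hchain ⊢
    refine ⟨isChain_reverse_iff.2 hchain.1, hchain.2.1, ?_⟩
    simp [hv, hadj]
  · rw [e1, e2]
    refine (Finset.card_le_card (t := {s(y, x), s(v, x)}) ?_).trans Finset.card_le_two
    intro e
    simp only [Finset.mem_symmDiff, Finset.mem_insert, Finset.mem_singleton]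
    tauto
  · rw [e1, e2]
    intro e
    simp only [Finset.mem_insert]
    tauto

/-- Replacing both parts of a path `Q₁ ++ Q₂` by reroutings which keep the two vertices at which
the parts are joined. -/
lemma Reroutes.glue {G : SimpleGraph V} {Q₁ Q₂ L M : List V} {c c' : ℕ}
    (h : (Q₁ ++ Q₂).IsChain G.Adj) (hQ₁ : Q₁ ≠ []) (hQ₂ : Q₂ ≠ [])
    (hL : Reroutes G Q₁ L c) (hM : Reroutes G Q₂.reverse M c') :
    (L ++ M.reverse).Perm (Q₁ ++ Q₂) ∧ (L ++ M.reverse).IsChain G.Adj ∧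
      (symmDiff (pathEdges (Q₁ ++ Q₂)) (pathEdges (L ++ M.reverse))).card ≤ c + c' := by
  obtain ⟨x, hx⟩ : ∃ x, Q₁.getLast? = some x := ⟨_, List.getLast?_eq_some_getLast hQ₁⟩
  obtain ⟨y, hy⟩ : ∃ y, Q₂.head? = some y := ⟨_, List.head?_eq_some_head hQ₂⟩
  have hLx : L.getLast? = some x := hL.last.trans hx
  have hMy : M.reverse.head? = some y := by
    rw [List.head?_reverse, hM.last, List.getLast?_reverse, hy]
  refine ⟨?_, ?_, ?_⟩
  · refine List.Perm.append hL.perm ((List.reverse_perm _).trans ?_)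
    exact hM.perm.trans (List.reverse_perm _)
  · rw [List.isChain_append] at h ⊢
    refine ⟨hL.chain, isChain_reverse_iff.2 hM.chain, ?_⟩
    rw [hLx, hMy, ← hx, ← hy]
    exact h.2.2
  · rw [pathEdges_append hx hy, pathEdges_append hLx hMy, pathEdges_reverse]
    have h1 := hL.card_le
    have h2 := hM.card_le
    rw [pathEdges_reverse] at h2
    refine (Finset.card_le_card (t := symmDiff (pathEdges Q₁) (pathEdges L) ∪
      symmDiff (pathEdges Q₂) (pathEdges M)) ?_).trans ((Finset.card_union_le _ _).trans
        (add_le_add h1 h2))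
    intro e
    simp only [Finset.mem_symmDiff, Finset.mem_insert, Finset.mem_union]
    tauto

end PathLists

section Expansion

variable {V : Type*} [Fintype V] [DecidableEq V]

open scoped Classical in
/-- The number of neighbours of `v` inside the set `I`. -/
noncomputable def degIn (G : SimpleGraph V) (I : Finset V) (v : V) : ℕ :=
  (I.filter (G.Adj v)).card

/-- One round of rotations: if `A` consists of first vertices of reroutings of `Q`, and every
edge of `Q` lost by such a rerouting meets `A`, then a pivot outside `A` and its neighbourhood
along `Q` yields a new first vertex next to the pivot on `Q`. -/
lemma exists_rotation {G : SimpleGraph V} {Q L : List V} (hQ : Q.Nodup) {A : Finset V} {v x u w : V}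
    {c : ℕ} (hL : Reroutes G Q L c) (hLv : L.head? = some v)
    (hmiss : ∀ e ∈ pathEdges Q, e ∉ pathEdges L → ∃ z ∈ A, z ∈ e)
    (hvx : G.Adj v x) (hxA : x ∉ A) (hxN : x ∉ A.biUnion (pathNbrs Q))
    (huw : u ≠ w) (hu : s(x, u) ∈ pathEdges Q) (hw : s(x, w) ∈ pathEdges Q) :
    ∃ y, (y = u ∨ y = w) ∧ ∃ L', Reroutes G Q L' (c + 2) ∧ L'.head? = some y ∧
      ∀ e ∈ pathEdges Q, e ∉ pathEdges L' → ∃ z ∈ insert y A, z ∈ e := by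
  have hxL : x ∈ L := hL.perm.mem_iff.2 (mem_of_mem_pathEdges hu).1
  have hLnd : L.Nodup := hL.perm.nodup_iff.2 hQ
  have keep : ∀ z, s(x, z) ∈ pathEdges Q → s(x, z) ∈ pathEdges L := by
    intro z hz
    by_contra hzL
    obtain ⟨t, htA, ht⟩ := hmiss _ hz hzL
    rcases Sym2.mem_iff.1 ht with rfl | rfl
    · exact hxA htA
    · refine hxN (Finset.mem_biUnion.2 ⟨t, htA, ?_⟩)
      simpa [pathNbrs, Sym2.eq_swap] using hz
  obtain ⟨X, B, rfl⟩ := List.append_of_mem hxL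
  have hX : X ≠ [] := by
    rintro rfl
    simp only [List.nil_append, List.head?_cons, Option.some.injEq] at hLv
    exact hvx.ne hLv.symm
  have hXv : X.head? = some v := by
    rwa [List.head?_append_of_ne_nil _ hX] at hLv
  obtain ⟨y, hy⟩ : ∃ y, X.getLast? = some y := ⟨_, List.getLast?_eq_some_getLast hX⟩
  have hyuw : y = u ∨ y = w := by
    have h1 := getLast?_eq_or_head?_eq_of_mem_pathEdges hLnd (keep u hu)
    have h2 := getLast?_eq_or_head?_eq_of_mem_pathEdges hLnd (keep w hw)
    rw [hy] at h1 h2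
    simp only [Option.some.injEq] at h1 h2
    rcases h1 with h1 | h1
    · exact Or.inl h1
    rcases h2 with h2 | h2
    · exact Or.inr h2
    · rw [h1] at h2
      exact absurd (Option.some.inj h2) huw
  obtain ⟨hrot, hlost⟩ := rotate hL.chain hXv hy hvx
  refine ⟨y, hyuw, _, hL.trans hrot, ?_, ?_⟩
  · rw [List.head?_append_of_ne_nil _ (by simpa using hX)]
    simpa using hy
  · intro e he he'
    by_cases heL : e ∈ pathEdges (X ++ x :: B)
    · exact ⟨y, by simp, by simp [hlost e heL he']⟩
    · obtain ⟨z, hz, hze⟩ := hmiss e he heL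
      exact ⟨z, Finset.mem_insert_of_mem hz, hze⟩

/-- The set of first vertices reachable by rotations grows geometrically, by a factor `g` per
round, up to the threshold `β`. -/
theorem exists_rotation_endpoints {G : SimpleGraph V} {Q : List V} (hQ : Q.Nodup)
    (hQc : Q.IsChain G.Adj) {a : V} (ha : Q.head? = some a) {I Z : Finset V} {β g τ : ℝ} {T : ℕ}
    (haZ : a ∈ Z)
    (hI : ∀ x ∈ I, x ≠ a → ∃ u w, u ≠ w ∧ u ∈ Z ∧ w ∈ Z ∧
      s(x, u) ∈ pathEdges Q ∧ s(x, w) ∈ pathEdges Q)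
    (hdeg : ∀ L v, Reroutes G Q L (2 * T) → L.head? = some v → v ∈ Z → τ ≤ degIn G I v)
    (hexp : ∀ A N : Finset V, (∀ v ∈ A, τ ≤ degIn G N v) →
      5 * β ≤ N.card ∨ 5 * g * A.card ≤ N.card) (hg : 0 ≤ g) :
    ∃ A : Finset V, (β ≤ A.card ∨ g ^ T ≤ A.card) ∧
      ∀ v ∈ A, v ∈ Z ∧ ∃ L, Reroutes G Q L (2 * T) ∧ L.head? = some v := by
  classical
  have key : ∀ t ≤ T, ∃ A : Finset V, a ∈ A ∧ (β ≤ A.card ∨ g ^ t ≤ A.card) ∧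
      ∀ v ∈ A, v ∈ Z ∧ ∃ L, Reroutes G Q L (2 * t) ∧ L.head? = some v ∧
        ∀ e ∈ pathEdges Q, e ∉ pathEdges L → ∃ z ∈ A, z ∈ e := by
    intro t
    induction t with
    | zero =>
      intro _
      refine ⟨{a}, by simp, Or.inr (by simp), ?_⟩
      intro v hv
      rw [Finset.mem_singleton.1 hv]
      exact ⟨haZ, Q, Reroutes.refl hQc, ha, fun e he he' => absurd he he'⟩
    | succ t ih =>
      intro ht
      obtain ⟨A, haA, hcard, hA⟩ := ih (by omega)
      set A' : Finset V := Finset.univ.filter fun y => y ∈ Z ∧ ∃ L, Reroutes G Q L (2 * (t + 1)) ∧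
        L.head? = some y ∧ ∀ e ∈ pathEdges Q, e ∉ pathEdges L → ∃ z ∈ insert y A, z ∈ e with hA'
      have hAA' : A ⊆ A' := by
        intro v hv
        obtain ⟨hvZ, L, hL, hLv, hm⟩ := hA v hv
        simp only [hA', Finset.mem_filter, Finset.mem_univ, true_and]
        refine ⟨hvZ, L, hL.mono (by omega), hLv, fun e he he' => ?_⟩
        obtain ⟨z, hz, hze⟩ := hm e he he'
        exact ⟨z, Finset.mem_insert_of_mem hz, hze⟩
      refine ⟨A', hAA' haA, ?_, ?_⟩
      · set N : Finset V := I.filter fun x => ∃ v ∈ A, G.Adj v x with hN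
        have hNsub : N ⊆ A ∪ A.biUnion (pathNbrs Q) ∪ A'.biUnion (pathNbrs Q) := by
          intro x hx
          simp only [hN, Finset.mem_filter] at hx
          obtain ⟨hxI, v, hvA, hvx⟩ := hx
          by_cases hxA : x ∈ A
          · simp [hxA]
          by_cases hxN : x ∈ A.biUnion (pathNbrs Q)
          · simp only [Finset.mem_union, hxN, or_true, true_or]
          obtain ⟨u, w, huw, huZ, hwZ, hu, hw⟩ := hI x hxI (fun h => hxA (h ▸ haA))
          obtain ⟨hvZ, L, hL, hLv, hm⟩ := hA v hvA
          obtain ⟨y, hy, L', hL', hLy, hm'⟩ :=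
            exists_rotation hQ hL hLv hm hvx hxA hxN huw hu hw
          refine Finset.mem_union_right _ (Finset.mem_biUnion.2 ⟨y, ?_, ?_⟩)
          · simp only [hA', Finset.mem_filter, Finset.mem_univ, true_and]
            refine ⟨?_, L', hL', hLy, hm'⟩
            rcases hy with rfl | rfl <;> assumption
          · simp only [pathNbrs, Finset.mem_filter, Finset.mem_univ, true_and]
            rw [Sym2.eq_swap]
            rcases hy with rfl | rfl <;> assumption
        have hNcard : N.card ≤ 5 * A'.card := by
          have h1 := Finset.card_le_card hNsub
          have h2 := Finset.card_union_le (A ∪ A.biUnion (pathNbrs Q)) (A'.biUnion (pathNbrs Q))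
          have h3 := Finset.card_union_le A (A.biUnion (pathNbrs Q))
          have h4 := card_biUnion_pathNbrs_le hQ A
          have h5 := card_biUnion_pathNbrs_le hQ A'
          have h6 := Finset.card_le_card hAA'
          omega
        have hNcard' : (N.card : ℝ) ≤ 5 * A'.card := by exact_mod_cast hNcard
        have hA'card : (A.card : ℝ) ≤ A'.card := by exact_mod_cast Finset.card_le_card hAA'
        have hdegN : ∀ v ∈ A, τ ≤ degIn G N v := by
          intro v hv
          obtain ⟨hvZ, L, hL, hLv, _⟩ := hA v hv
          refine (hdeg L v (hL.mono (by omega)) hLv hvZ).trans ?_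
          unfold degIn
          exact_mod_cast Finset.card_le_card fun x hx => by
            simp only [Finset.mem_filter] at hx
            simp only [hN, Finset.mem_filter]
            exact ⟨⟨hx.1, v, hv, hx.2⟩, hx.2⟩
        rcases hcard with hcard | hcard
        · exact Or.inl (hcard.trans hA'card)
        rcases hexp A N hdegN with h | h
        · left; linarith
        · right
          have : g * g ^ t ≤ g * A.card := mul_le_mul_of_nonneg_left hcard hg
          rw [pow_succ']
          linarith
      · intro v hv
        simp only [hA', Finset.mem_filter, Finset.mem_univ, true_and] at hv
        obtain ⟨hvZ, L, hL, hLv, hm⟩ := hv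
        refine ⟨hvZ, L, hL, hLv, fun e he he' => ?_⟩
        obtain ⟨z, hz, hze⟩ := hm e he he'
        rcases Finset.mem_insert.1 hz with rfl | hz
        · refine ⟨z, ?_, hze⟩
          simp only [hA', Finset.mem_filter, Finset.mem_univ, true_and]
          exact ⟨hvZ, L, hL, hLv, hm⟩
        · exact ⟨z, hAA' hz, hze⟩
  obtain ⟨A, _, hcard, hA⟩ := key T le_rfl
  exact ⟨A, hcard, fun v hv => ⟨(hA v hv).1, (hA v hv).2.imp fun L h => ⟨h.1, h.2.1⟩⟩⟩

end Expansion

section Mixing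

variable {V : Type*}

/-- `e(U, W)` differs from `p |U| |W|` by at most `lam √(|U| |W|)`. -/
def IsMixing (G : SimpleGraph V) (p lam : ℝ) : Prop :=
  ∀ U W : Finset V, |(∑ v ∈ U, (degIn G W v : ℝ)) - p * U.card * W.card| ≤
    lam * √((U.card : ℝ) * W.card)

lemma degIn_mono {G : SimpleGraph V} {I J : Finset V} (h : I ⊆ J) (v : V) :
    degIn G I v ≤ degIn G J v := by
  classical
  exact Finset.card_le_card (Finset.filter_subset_filter _ h)

lemma sq_mul_le_of_mul_le_mul_sqrt {a b x : ℝ} (ha : 0 ≤ a) (hx : 0 ≤ x) (h : a * x ≤ b * √x) :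
    a ^ 2 * x ≤ b ^ 2 := by
  rcases hx.eq_or_lt with rfl | hx'
  · simpa using sq_nonneg b
  have hs : 0 < √x := Real.sqrt_pos.2 hx'
  have h1 : a * √x ≤ b := by
    by_contra! hlt
    have h2 := mul_lt_mul_of_pos_right hlt hs
    rw [mul_assoc, Real.mul_self_sqrt hx] at h2
    linarith
  have h2 := pow_le_pow_left₀ (by positivity) h1 2
  rwa [mul_pow, Real.sq_sqrt hx] at h2

lemma IsMixing.expand {G : SimpleGraph V} {p lam τ : ℝ} (h : IsMixing G p lam) (hp : 0 < p)
    (hlam : 0 < lam) (hτ : 0 < τ) (A N : Finset V) (hA : ∀ v ∈ A, τ ≤ degIn G N v) :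
    5 * (τ / (10 * p)) ≤ N.card ∨ 5 * (τ ^ 2 / (20 * lam ^ 2)) * A.card ≤ N.card := by
  rcases A.eq_empty_or_nonempty with rfl | hne
  · right; simp
  by_cases hN : 5 * (τ / (10 * p)) ≤ N.card
  · exact Or.inl hN
  right
  have hApos : (0 : ℝ) < A.card := by exact_mod_cast hne.card_pos
  have h1 : p * N.card ≤ τ / 2 := by
    have h2 : (N.card : ℝ) ≤ 5 * (τ / (10 * p)) := (not_le.1 hN).le
    have h3 := mul_le_mul_of_nonneg_left h2 hp.le
    have h4 : p * (5 * (τ / (10 * p))) = τ / 2 := by field_simp; norm_num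
    linarith
  have h2 : A.card * τ ≤ ∑ v ∈ A, (degIn G N v : ℝ) := by
    rw [← nsmul_eq_mul]
    exact Finset.card_nsmul_le_sum _ _ _ hA
  have h3 := (abs_le.1 (h A N)).2
  have h4 : A.card * (τ / 2) ≤ lam * √((A.card : ℝ) * N.card) := by
    have := mul_le_mul_of_nonneg_left h1 hApos.le
    linarith
  have h5 := pow_le_pow_left₀ (by positivity) h4 2
  rw [mul_pow lam, Real.sq_sqrt (by positivity)] at h5
  have h6 : (A.card : ℝ) * (A.card * τ ^ 2) ≤ A.card * (4 * lam ^ 2 * N.card) := by linarith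
  have h7 := le_of_mul_le_mul_left h6 hApos
  have : 5 * (τ ^ 2 / (20 * lam ^ 2)) * A.card = A.card * τ ^ 2 / (4 * lam ^ 2) := by
    field_simp; norm_num
  rw [this, div_le_iff₀ (by positivity)]
  linarith

/-- Few vertices have less than half of the expected number of neighbours in a given set. -/
lemma IsMixing.card_mul_card_le {G : SimpleGraph V} {p lam : ℝ} (h : IsMixing G p lam)
    (hp : 0 < p) (Z W : Finset V) (hZ : ∀ v ∈ Z, (degIn G W v : ℝ) ≤ p / 2 * W.card) :
    p ^ 2 * (Z.card * W.card) ≤ 4 * lam ^ 2 := by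
  have h1 : ∑ v ∈ Z, (degIn G W v : ℝ) ≤ Z.card * (p / 2 * W.card) := by
    rw [← nsmul_eq_mul]
    exact Finset.sum_le_card_nsmul _ _ _ hZ
  have h2 := (abs_le.1 (h Z W)).1
  have h3 : p / 2 * ((Z.card : ℝ) * W.card) ≤ lam * √((Z.card : ℝ) * W.card) := by linarith
  have h4 := sq_mul_le_of_mul_le_mul_sqrt (by positivity) (by positivity) h3
  linarith

lemma IsMixing.exists_adj {G : SimpleGraph V} {p lam : ℝ} (h : IsMixing G p lam)
    (hp : 0 < p) (A B : Finset V) (hAB : lam ^ 2 < p ^ 2 * (A.card * B.card)) :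
    ∃ a ∈ A, ∃ b ∈ B, G.Adj a b := by
  classical
  by_contra! hno
  have h0 : ∑ v ∈ A, (degIn G B v : ℝ) = 0 := by
    refine Finset.sum_eq_zero fun v hv => ?_
    have : degIn G B v = 0 := by
      unfold degIn
      rw [Finset.card_eq_zero, Finset.filter_eq_empty_iff]
      exact fun b hb => hno v hv b hb
    simp [this]
  have h2 := (abs_le.1 (h A B)).1
  rw [h0] at h2
  have h3 := sq_mul_le_of_mul_le_mul_sqrt (a := p) (b := lam) hp.le
    (x := (A.card : ℝ) * B.card) (by positivity) (by linarith)
  linarith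

/-- There is a small set `Y` such that every vertex outside `Y` has many neighbours in each `I j`
away from `Y` and from the sets `nb y`, `y ∈ Y`. -/
theorem IsMixing.exists_exceptional [Fintype V] [DecidableEq V] {G : SimpleGraph V}
    {p lam : ℝ} (h : IsMixing G p lam) (hp : 0 < p) (nb : V → Finset V) (hnb : ∀ v, (nb v).card ≤ 2) (I : ℕ → Finset V) {m s k : ℕ}
    (hs : 0 < s) (hI : ∀ j < m, (I j).card = s) (hk : 6 * k ≤ s)
    (hm : m * (8 * lam ^ 2) < k * (p ^ 2 * s)) :
    ∃ Y : Finset V, Y.card ≤ k ∧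
      ∀ v ∉ Y, ∀ j < m, p * s / 4 ≤ degIn G (I j \ (Y ∪ Y.biUnion nb)) v := by
  classical
  set bad : Finset V → V → ℕ → Prop := fun Y v j =>
    (degIn G (I j \ (Y ∪ Y.biUnion nb)) v : ℝ) < p * s / 4 with hbad
  set F : Finset (Finset V) := Finset.univ.filter fun Y =>
    Y.card ≤ k ∧ ∀ v ∈ Y, ∃ j < m, bad Y v j with hF
  have hFne : F.Nonempty := ⟨∅, by simp [hF]⟩
  obtain ⟨Y, hYF, hmax⟩ := F.exists_max_image Finset.card hFne
  simp only [hF, Finset.mem_filter, Finset.mem_univ, true_and] at hYF hmax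
  obtain ⟨hYk, hYbad⟩ := hYF
  have hsR : (0 : ℝ) < s := by exact_mod_cast hs
  have hsmall : Y.card < k := by
    have hj : ∀ j < m, ((Y.filter fun v => bad Y v j).card : ℝ) * (p ^ 2 * s) ≤ 8 * lam ^ 2 := by
      intro j hjm
      set W := I j \ (Y ∪ Y.biUnion nb) with hW
      have hWcard : (s : ℝ) / 2 ≤ W.card := by
        have h1 := Finset.le_card_sdiff (Y ∪ Y.biUnion nb) (I j)
        have h2 := Finset.card_union_le Y (Y.biUnion nb)
        have h3 := Finset.card_biUnion_le_card_mul Y nb 2 fun v _ => hnb v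
        have h4 : s ≤ 2 * W.card := by
          rw [hI j hjm, ← hW] at h1
          omega
        have h5 : (s : ℝ) ≤ 2 * W.card := by exact_mod_cast h4
        linarith
      have h1 := h.card_mul_card_le hp (Y.filter fun v => bad Y v j) W (fun v hv => by
        have := (Finset.mem_filter.1 hv).2
        simp only [hbad] at this
        nlinarith)
      have h2 : ((Y.filter fun v => bad Y v j).card : ℝ) * (p ^ 2) * (s / 2) ≤
          ((Y.filter fun v => bad Y v j).card : ℝ) * (p ^ 2) * W.card :=
        mul_le_mul_of_nonneg_left hWcard (by positivity)
      linarith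
    have hcov : Y ⊆ (Finset.range m).biUnion fun j => Y.filter fun v => bad Y v j := by
      intro v hv
      obtain ⟨j, hjm, hb⟩ := hYbad v hv
      exact Finset.mem_biUnion.2 ⟨j, Finset.mem_range.2 hjm, Finset.mem_filter.2 ⟨hv, hb⟩⟩
    have hcard := (Finset.card_le_card hcov).trans Finset.card_biUnion_le
    have hcard' : (Y.card : ℝ) ≤
        ∑ j ∈ Finset.range m, ((Y.filter fun v => bad Y v j).card : ℝ) := by exact_mod_cast hcard
    have h3 : (Y.card : ℝ) * (p ^ 2 * s) ≤ m * (8 * lam ^ 2) := by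
      refine (mul_le_mul_of_nonneg_right hcard' (by positivity)).trans ?_
      rw [Finset.sum_mul]
      refine (Finset.sum_le_card_nsmul _ _ (8 * lam ^ 2)
        fun j hj' => hj j (Finset.mem_range.1 hj')).trans ?_
      simp
    have h4 := lt_of_mul_lt_mul_right (h3.trans_lt hm) (by positivity)
    exact_mod_cast h4
  refine ⟨Y, hYk, fun v hv j hjm => ?_⟩
  by_contra! hlt
  have hanti : ∀ w i, bad Y w i → bad (insert v Y) w i := by
    intro w i hwi
    refine lt_of_le_of_lt ?_ hwi
    exact_mod_cast degIn_mono (Finset.sdiff_subset_sdiff le_rfl (Finset.union_subset_union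
      (Finset.subset_insert v Y) (Finset.biUnion_subset_biUnion_of_subset_left _
        (Finset.subset_insert v Y)))) w
  have hins := hmax (insert v Y) ⟨by rw [Finset.card_insert_of_notMem hv]; omega, by
    intro w hw
    rcases Finset.mem_insert.1 hw with rfl | hw
    · exact ⟨j, hjm, hanti _ _ hlt⟩
    · obtain ⟨i, hi, hb⟩ := hYbad w hw
      exact ⟨i, hi, hanti _ _ hb⟩⟩
  rw [Finset.card_insert_of_notMem hv] at hins
  omega

end Mixing

section Segments

variable {V : Type*} [DecidableEq V]

/-- If few of the edges along `f 0, f 1, …` are missing from `E₁ ∪ E₂` and `V₂` is not too large,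
then some segment of length `q` is spanned entirely by edges of `E₁`. -/
theorem exists_intact_segment {f : ℕ → V} {l q m c : ℕ} (hinj : Set.InjOn f (Set.Iio l))
    (hml : m * q ≤ l) {E₁ E₂ M : Finset (Sym2 V)} {V₁ V₂ : Finset V}
    (hdisj : Disjoint V₁ V₂)
    (hE₁ : ∀ x y, s(x, y) ∈ E₁ → x ∈ V₁ ∧ y ∈ V₁) (hE₂ : ∀ x y, s(x, y) ∈ E₂ → x ∈ V₂ ∧ y ∈ V₂)
    (hM : ∀ i, i + 1 < l → s(f i, f (i + 1)) ∈ E₁ ∨ s(f i, f (i + 1)) ∈ E₂ ∨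
      s(f i, f (i + 1)) ∈ M)
    (hc : M.card ≤ c) (hV₂ : V₂.card < (m - c) * q) :
    ∃ j < m, ∀ k, k + 1 < q → s(f (j * q + k), f (j * q + k + 1)) ∈ E₁ := by
  classical
  have hq : 0 < q := Nat.pos_of_ne_zero (by rintro rfl; simp at hV₂)
  have hlt : ∀ j < m, ∀ k < q, j * q + k < l := by
    intro j hj k hk
    have : (j + 1) * q ≤ m * q := Nat.mul_le_mul_right _ hj
    rw [add_mul] at this
    omega
  by_contra! hno
  set good : ℕ → Prop := fun j => ∀ k, k + 1 < q →
    s(f (j * q + k), f (j * q + k + 1)) ∈ E₁ ∨ s(f (j * q + k), f (j * q + k + 1)) ∈ E₂ with hgood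
  have hside : ∀ j < m, good j → ∀ k < q, f (j * q + k) ∈ V₂ := by
    intro j hj hg
    have hnot : ∀ {x}, x ∈ V₁ → x ∉ V₂ := fun h => Finset.disjoint_left.1 hdisj h
    have hstep : ∀ k, k + 1 < q → (f (j * q + k) ∈ V₂ ↔ f (j * q + k + 1) ∈ V₂) := by
      intro k hk
      rcases hg k hk with h | h
      · have := hE₁ _ _ h
        simp [hnot this.1, hnot this.2]
      · have := hE₂ _ _ h
        simp [this.1, this.2]
    have hall : ∀ k < q, (f (j * q) ∈ V₂ ↔ f (j * q + k) ∈ V₂) := by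
      intro k
      induction k with
      | zero => simp
      | succ k ih => exact fun hk => (ih (by omega)).trans (hstep k hk)
    by_cases h0 : f (j * q) ∈ V₂
    · exact fun k hk => (hall k hk).1 h0
    · obtain ⟨k, hk, hkE⟩ := hno j hj
      have h1 := hE₂ _ _ ((hg k hk).resolve_left hkE)
      exact absurd ((hall k (by omega)).2 h1.1) h0
  set S := (Finset.range m).filter good with hS
  set B := (Finset.range m).filter fun j => ¬ good j with hB
  have hSB : S.card + B.card = m := by
    have := Finset.card_filter_add_card_filter_not (s := Finset.range m) good
    simpa [hS, hB] using this
  have hBM : B.card ≤ M.card := by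
    have hex : ∀ j ∈ B, ∃ k, k + 1 < q ∧ s(f (j * q + k), f (j * q + k + 1)) ∈ M := by
      intro j hj
      simp only [hB, hgood, Finset.mem_filter, Finset.mem_range] at hj
      obtain ⟨hjm, hj⟩ := hj
      push Not at hj
      obtain ⟨k, hk, h1, h2⟩ := hj
      exact ⟨k, hk, ((hM _ (hlt j hjm (k + 1) hk)).resolve_left h1).resolve_left h2⟩
    choose! κ hκ hκM using hex
    refine Finset.card_le_card_of_injOn (fun j => s(f (j * q + κ j), f (j * q + κ j + 1)))
      (fun j hj => hκM j hj) ?_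
    intro i hi j hj hij
    simp only [Sym2.eq_iff] at hij
    have hi' := hκ i hi
    have hj' := hκ j hj
    have him : i < m := Finset.mem_range.1 (Finset.mem_filter.1 hi).1
    have hjm : j < m := Finset.mem_range.1 (Finset.mem_filter.1 hj).1
    have hdiv : ∀ i k, k < q → (i * q + k) / q = i := by
      intro i k hk
      rw [mul_comm, Nat.mul_add_div hq, Nat.div_eq_of_lt hk, add_zero]
    have a1 := hdiv i (κ i) (by omega)
    rcases hij with ⟨h, _⟩ | ⟨h, _⟩
    · have := hinj (hlt i him _ (by omega)) (hlt j hjm _ (by omega)) h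
      rw [this, hdiv j _ (by omega)] at a1
      exact a1.symm
    · have := hinj (hlt i him _ (by omega)) (hlt j hjm (κ j + 1) (by omega)) h
      rw [this, hdiv j (κ j + 1) (by omega)] at a1
      exact a1.symm
  have hSV : (S ×ˢ Finset.range q).card ≤ V₂.card := by
    refine Finset.card_le_card_of_injOn (fun z => f (z.1 * q + z.2)) ?_ ?_
    · intro z hz
      simp only [hS, Finset.coe_product, Set.mem_prod, Finset.mem_coe, Finset.mem_filter,
        Finset.mem_range] at hz
      exact hside _ hz.1.1 hz.1.2 _ hz.2
    · intro z hz w hw hzw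
      simp only [hS, Finset.coe_product, Set.mem_prod, Finset.mem_coe, Finset.mem_filter,
        Finset.mem_range] at hz hw
      have := hinj (hlt _ hz.1.1 _ hz.2) (hlt _ hw.1.1 _ hw.2) hzw
      have h1 : z.1 = w.1 := by
        have h2 : (z.1 * q + z.2) / q = z.1 := by
          rw [mul_comm, Nat.mul_add_div hq, Nat.div_eq_of_lt hz.2, add_zero]
        have h3 : (w.1 * q + w.2) / q = w.1 := by
          rw [mul_comm, Nat.mul_add_div hq, Nat.div_eq_of_lt hw.2, add_zero]
        rw [← h2, ← h3, this]
      refine Prod.ext h1 ?_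
      rw [h1] at this
      omega
  rw [Finset.card_product, Finset.card_range] at hSV
  have : (m - c) * q ≤ S.card * q := Nat.mul_le_mul_right _ (by omega)
  omega

end Segments

section Rerouting

variable {V : Type*} [DecidableEq V]

lemma getD_mem_pathEdges {L : List V} (a : V) {i : ℕ} (hi : i + 1 < L.length) :
    s(L.getD i a, L.getD (i + 1) a) ∈ pathEdges L := by
  have h := pathEdges_append (X := L.take (i + 1)) (Y := L.drop (i + 1)) (c := L.getD i a)
    (e := L.getD (i + 1) a)
    (by rw [List.getLast?_take]; simp [List.getD_eq_getElem?_getD,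
          List.getElem?_eq_getElem (show i < L.length by omega)])
    (by rw [List.head?_drop, List.getD_eq_getElem?_getD, List.getElem?_eq_getElem hi]; rfl)
  rw [List.take_append_drop] at h
  rw [h]
  exact Finset.mem_insert_self _ _

lemma exists_two_pathEdges {Q : List V} (hQ : Q.Nodup) {x : V} (hx : x ∈ Q)
    (hhead : Q.head? ≠ some x) (hlast : Q.getLast? ≠ some x) :
    ∃ u w, u ≠ w ∧ s(x, u) ∈ pathEdges Q ∧ s(x, w) ∈ pathEdges Q := by
  obtain ⟨A, B, rfl⟩ := List.append_of_mem hx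
  have hA : A ≠ [] := by rintro rfl; simp at hhead
  have hB : B ≠ [] := by rintro rfl; simp at hlast
  obtain ⟨u, hu⟩ : ∃ u, A.getLast? = some u := ⟨_, List.getLast?_eq_some_getLast hA⟩
  obtain ⟨w, B, rfl⟩ := List.exists_cons_of_ne_nil hB
  refine ⟨u, w, ?_, ?_, ?_⟩
  · rintro rfl
    have := List.disjoint_of_nodup_append hQ (List.mem_of_getLast? hu)
    simp at this
  · rw [pathEdges_append hu (by simp : (x :: w :: B).head? = some x), Sym2.eq_swap]
    exact Finset.mem_insert_self _ _
  · rw [pathEdges_append hu (by simp : (x :: w :: B).head? = some x)]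
    simp [pathEdges]

variable [Fintype V]

theorem IsMixing.exists_endpoints {G : SimpleGraph V} {n p lam τ : ℝ} {T : ℕ}
    (hmix : IsMixing G p lam) (hp : 0 < p) (hlam : 0 < lam) (hτ : 0 < τ)
    (hτn : τ / (10 * p) ≤ n) (hgrow : n ≤ (τ ^ 2 / (20 * lam ^ 2)) ^ T)
    {Q : List V} (hQ : Q.Nodup) (hQc : Q.IsChain G.Adj) {a : V} (ha : Q.head? = some a)
    {I Z : Finset V} (haZ : a ∈ Z)
    (hI : ∀ x ∈ I, x ≠ a → ∃ u w, u ≠ w ∧ u ∈ Z ∧ w ∈ Z ∧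
      s(x, u) ∈ pathEdges Q ∧ s(x, w) ∈ pathEdges Q)
    (hdeg : ∀ L v, Reroutes G Q L (2 * T) → L.head? = some v → v ∈ Z → τ ≤ degIn G I v) :
    ∃ A : Finset V, τ / (10 * p) ≤ A.card ∧
      ∀ v ∈ A, v ∈ Z ∧ ∃ L, Reroutes G Q L (2 * T) ∧ L.head? = some v := by
  obtain ⟨A, hA, hAL⟩ := exists_rotation_endpoints hQ hQc ha haZ hI hdeg
    (fun A N => hmix.expand hp hlam hτ A N) (by positivity)
  exact ⟨A, hA.elim id fun h => hτn.trans (hgrow.trans h), hAL⟩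

/-- If no rerouting of `Q` can be extended at its first vertex, then linearly many vertices are
first vertices of reroutings. -/
theorem IsMixing.exists_endpoints_of_stuck {G : SimpleGraph V} {n p lam : ℝ} {T : ℕ}
    (hmix : IsMixing G p lam) (hp : 0 < p) (hlam : 0 < lam) (hn : 0 < n)
    (hmin : ∀ v, p * n / 2 + 1 ≤ degIn G Finset.univ v)
    (hgrow : n ≤ ((p * n / 2) ^ 2 / (20 * lam ^ 2)) ^ T)
    {Q : List V} (hQ : Q.Nodup) (hQc : Q.IsChain G.Adj) (hQ0 : Q ≠ [])
    (hstuck : ∀ L v y, Reroutes G Q L (2 * T) → L.head? = some v → G.Adj v y → y ∈ Q) :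
    ∃ A : Finset V, n / 20 ≤ A.card ∧ ∀ v ∈ A, ∃ L, Reroutes G Q L (2 * T) ∧ L.head? = some v := by
  classical
  obtain ⟨a, ha⟩ : ∃ a, Q.head? = some a := ⟨_, List.head?_eq_some_head hQ0⟩
  obtain ⟨b, hb⟩ : ∃ b, Q.getLast? = some b := ⟨_, List.getLast?_eq_some_getLast hQ0⟩
  have e : p * n / 2 / (10 * p) = n / 20 := by field_simp; norm_num
  have hI : ∀ x ∈ Q.toFinset.erase b, x ≠ a → ∃ u w, u ≠ w ∧ u ∈ Finset.univ ∧ w ∈ Finset.univ ∧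
      s(x, u) ∈ pathEdges Q ∧ s(x, w) ∈ pathEdges Q := by
    intro x hx hxa
    rw [Finset.mem_erase, List.mem_toFinset] at hx
    obtain ⟨u, w, huw, hu, hw⟩ := exists_two_pathEdges hQ hx.2
      (by rw [ha]; simpa using hxa.symm) (by rw [hb]; simpa using hx.1.symm)
    exact ⟨u, w, huw, Finset.mem_univ _, Finset.mem_univ _, hu, hw⟩
  have hdeg : ∀ L v, Reroutes G Q L (2 * T) → L.head? = some v → v ∈ Finset.univ →
      p * n / 2 ≤ degIn G (Q.toFinset.erase b) v := by
    intro L v hL hv _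
    have h1 : degIn G Finset.univ v ≤ degIn G (Q.toFinset.erase b) v + 1 := by
      unfold degIn
      have hsub : Finset.univ.filter (G.Adj v) ⊆
          insert b ((Q.toFinset.erase b).filter (G.Adj v)) := by
        intro y hy
        have hy := (Finset.mem_filter.1 hy).2
        have := hstuck L v y hL hv hy
        by_cases hyb : y = b <;> simp [hyb, this, hy]
      exact (Finset.card_le_card hsub).trans (Finset.card_insert_le _ _)
    have h2 : (degIn G Finset.univ v : ℝ) ≤ degIn G (Q.toFinset.erase b) v + 1 := by
      exact_mod_cast h1
    linarith [hmin v]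
  obtain ⟨A, hA, hAL⟩ := hmix.exists_endpoints hp hlam (by positivity) (by rw [e]; linarith) hgrow
    hQ hQc ha (Finset.mem_univ a) hI hdeg
  exact ⟨A, e ▸ hA, fun v hv => (hAL v hv).2⟩

/-- Some path on the vertices of `P`, differing from `P` in at most `c` edges, has adjacent end
vertices or can be extended. -/
def IsClosable (G : SimpleGraph V) (P : List V) (c : ℕ) : Prop :=
  ∃ L v w, L.Perm P ∧ L.IsChain G.Adj ∧ L.head? = some v ∧ L.getLast? = some w ∧
    (symmDiff (pathEdges P) (pathEdges L)).card ≤ c ∧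
    (G.Adj v w ∨ ∃ x y, (x = v ∨ x = w) ∧ y ∉ L ∧ G.Adj x y)

lemma exists_reroute_of_not_isClosable {G : SimpleGraph V} {n p lam : ℝ} {T : ℕ}
    (hmix : IsMixing G p lam) (hp : 0 < p) (hlam : 0 < lam) (hn : 0 < n)
    (hmin : ∀ v, p * n / 2 + 1 ≤ degIn G Finset.univ v)
    (hgrow : n ≤ ((p * n / 2) ^ 2 / (20 * lam ^ 2)) ^ T)
    {P Q : List V} (hP : P.Nodup) {c : ℕ} (hno : ¬ IsClosable G P (c + 2 * T))
    (hQP : Q.Perm P) (hQc : Q.IsChain G.Adj) (hQ0 : Q ≠ [])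
    (hQ : (symmDiff (pathEdges P) (pathEdges Q)).card ≤ c) :
    ∃ A : Finset V, n / 20 ≤ A.card ∧ ∀ v ∈ A, ∃ L, Reroutes G Q L (2 * T) ∧ L.head? = some v := by
  refine hmix.exists_endpoints_of_stuck hp hlam hn hmin hgrow (hQP.nodup_iff.2 hP) hQc hQ0 ?_
  intro L v y hL hv hvy
  by_contra hy
  obtain ⟨w, hw⟩ : ∃ w, L.getLast? = some w := by
    rw [hL.last]; exact ⟨_, List.getLast?_eq_some_getLast hQ0⟩
  exact hno ⟨L, v, w, hL.perm.trans hQP, hL.chain, hv, hw,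
    (card_symmDiff_le_add _ _ _).trans (add_le_add hQ hL.card_le),
    Or.inr ⟨v, y, Or.inl rfl, fun h => hy (hL.perm.mem_iff.1 h), hvy⟩⟩

end Rerouting

lemma exists_segment_length {T l : ℕ} {n : ℝ} (hT : 1 ≤ T) (hl : n / 20 ≤ l) (hln : l ≤ n)
    (hn : 10 ^ 9 * (T : ℝ) ^ 2 ≤ n) :
    ∃ s k : ℕ, 20 * T * (s + 2) ≤ l ∧ l + 1 < 2 * ((20 * T - (4 * T + 1)) * (s + 2)) ∧ 12 ≤ s ∧
      6 * k ≤ s ∧ s ≤ 12 * k ∧ n ≤ 1600 * T * s ∧ (s : ℝ) ≤ n / 20 := by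
  have hTR : (1 : ℝ) ≤ T := by exact_mod_cast hT
  set q := l / (20 * T) with hq
  have h1 : 20 * T * q ≤ l := Nat.mul_div_le _ _
  have h2 : l < 20 * T * (q + 1) := by
    rw [mul_comm]; exact Nat.lt_mul_of_div_lt (Nat.lt_succ_self _) (by omega)
  have h1R : 20 * (T : ℝ) * q ≤ l := by exact_mod_cast h1
  have h2R : (l : ℝ) < 20 * T * (q + 1) := by exact_mod_cast h2
  have hq20 : 20 ≤ q := by
    have h3 : (50000 : ℝ) * T * (20 * T) < (q + 1) * (20 * T) := by nlinarith
    have h4 := lt_of_mul_lt_mul_right h3 (by positivity)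
    have h5 : (20 : ℝ) < q := by nlinarith
    exact_mod_cast h5.le
  obtain ⟨s, hs⟩ : ∃ s, q = s + 2 := ⟨q - 2, by omega⟩
  rw [hs] at h1 h2 h1R h2R hq20
  have hsR : (12 : ℝ) ≤ s := by exact_mod_cast (by omega : 12 ≤ s)
  push_cast at h1R h2R
  refine ⟨s, s / 6, h1, ?_, by omega, by omega, by omega, ?_, ?_⟩
  · have h3 : 15 * T ≤ 20 * T - (4 * T + 1) := by omega
    have h4 := Nat.mul_le_mul_right (s + 2) h3
    nlinarith
  · have h6 : (T : ℝ) * 12 ≤ T * s := mul_le_mul_of_nonneg_left hsR (by positivity)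
    linarith
  · have h6 : (1 : ℝ) * s ≤ T * s := mul_le_mul_of_nonneg_right hTR (by positivity)
    linarith

section Closing

variable {V : Type*} [DecidableEq V] [Fintype V]

/-- Rotations with all pivots in one segment of `P` whose edges all belong to `Q`. -/
lemma IsMixing.exists_endpoints_of_segment {G : SimpleGraph V} {n p lam : ℝ} {T s q r : ℕ}
    (hmix : IsMixing G p lam) (hp : 0 < p) (hlam : 0 < lam) (hs : 0 < s) (hsn : (s : ℝ) ≤ n)
    (hgrow : n ≤ ((p * s / 4) ^ 2 / (20 * lam ^ 2)) ^ T)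
    {P Q : List V} (hQ : Q.Nodup) (hQc : Q.IsChain G.Adj) {a : V} (ha : Q.head? = some a)
    {Y : Finset V} (haY : a ∉ Y) {f : ℕ → V} (hinj : Set.InjOn f (Set.Iio P.length))
    (hf : ∀ i, i + 1 < P.length → s(f i, f (i + 1)) ∈ pathEdges P)
    (hq : q = s + 2) (hr : r + q ≤ P.length)
    (hseg : ∀ k, k + 1 < q → s(f (r + k), f (r + k + 1)) ∈ pathEdges Q)
    (hY : ∀ v ∉ Y, p * s / 4 ≤ degIn G ((Finset.range s).image (fun k => f (r + k + 1)) \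
      (Y ∪ Y.biUnion (pathNbrs P))) v) :
    ∃ A : Finset V, (s : ℝ) / 40 ≤ A.card ∧
      ∀ v ∈ A, ∃ L, Reroutes G Q L (2 * T) ∧ L.head? = some v := by
  have hsR : (0 : ℝ) < s := by exact_mod_cast hs
  have e : p * s / 4 / (10 * p) = s / 40 := by field_simp; norm_num
  have hI : ∀ x ∈ (Finset.range s).image (fun k => f (r + k + 1)) \ (Y ∪ Y.biUnion (pathNbrs P)),
      x ≠ a → ∃ u w, u ≠ w ∧ u ∈ Yᶜ ∧ w ∈ Yᶜ ∧ s(x, u) ∈ pathEdges Q ∧ s(x, w) ∈ pathEdges Q := by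
    intro x hx _
    simp only [Finset.mem_sdiff, Finset.mem_image, Finset.mem_range, Finset.mem_union,
      Finset.mem_biUnion, not_or, not_exists, not_and] at hx
    obtain ⟨⟨k, hk, rfl⟩, _, hxN⟩ := hx
    refine ⟨f (r + k), f (r + k + 1 + 1), ?_, ?_, ?_, ?_, ?_⟩
    · intro h
      have := hinj (by simp only [Set.mem_Iio]; omega) (by simp only [Set.mem_Iio]; omega) h
      omega
    · rw [Finset.mem_compl]
      intro hu
      exact hxN _ hu (by simpa [pathNbrs] using hf (r + k) (by omega))
    · rw [Finset.mem_compl]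
      intro hu
      refine hxN _ hu ?_
      simp only [pathNbrs, Finset.mem_filter, Finset.mem_univ, true_and]
      rw [Sym2.eq_swap]
      exact hf (r + k + 1) (by omega)
    · rw [Sym2.eq_swap]
      exact hseg k (by omega)
    · exact hseg (k + 1) (by omega)
  obtain ⟨A, hA, hAL⟩ := hmix.exists_endpoints hp hlam (by positivity) (by rw [e]; linarith) hgrow
    hQ hQc ha (by simpa using haY) hI (fun L v _ _ hv => hY v (by simpa using hv))
  exact ⟨A, e ▸ hA, fun v hv => (hAL v hv).2⟩

theorem IsMixing.isClosable {G : SimpleGraph V} {n p lam : ℝ} {T : ℕ}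
    (hmix : IsMixing G p lam) (hp : 0 < p) (hn : Fintype.card V ≤ n)
    (hlam : 1 / 2 ≤ lam) (hplam : p ≤ lam) (hmin : ∀ v, p * n - lam ≤ degIn G Finset.univ v)
    (hT : 1 ≤ T) (hr : 10 ^ 9 * (T : ℝ) ^ 2 * lam ≤ p * n) (hnT : n ≤ (p * n / lam) ^ T)
    {P : List V} (hP : P.Nodup) (hPc : P.IsChain G.Adj) (hP0 : P ≠ []) :
    IsClosable G P (8 * T) := by
  by_contra hno
  have hTR : (1 : ℝ) ≤ T := by exact_mod_cast hT
  have hlam0 : 0 < lam := by linarith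
  have hT2 : (1 : ℝ) ≤ (T : ℝ) ^ 2 := one_le_pow₀ hTR
  have hd : 10 ^ 9 * lam ≤ p * n := by
    have := mul_le_mul_of_nonneg_right hT2 hlam0.le
    linarith
  have hn9 : 10 ^ 9 * (T : ℝ) ^ 2 ≤ n := by
    have hn0 : 0 ≤ n := (Nat.cast_nonneg _).trans hn
    have h1 := hr.trans (mul_le_mul_of_nonneg_right hplam hn0)
    rw [mul_comm lam] at h1
    exact le_of_mul_le_mul_right h1 hlam0
  have hn0 : 0 < n := by linarith
  have hmin' : ∀ v, p * n / 2 + 1 ≤ degIn G Finset.univ v := fun v => by linarith [hmin v]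
  have hgrow₁ : n ≤ ((p * n / 2) ^ 2 / (20 * lam ^ 2)) ^ T := by
    refine hnT.trans (pow_le_pow_left₀ (by positivity) ?_ T)
    rw [div_le_div_iff₀ hlam0 (by positivity)]
    have h1 := mul_le_mul_of_nonneg_right hd (by positivity : 0 ≤ p * n * lam)
    have h2 : 0 ≤ p * n * lam * lam := by positivity
    nlinarith
  -- reroute both ends so that they avoid the exceptional set
  obtain ⟨A₁, hA₁, hA₁L⟩ := exists_reroute_of_not_isClosable (c := 0) (T := T) hmix hp hlam0 hn0
    hmin' hgrow₁ hP (fun ⟨L, v, w, h1, h2, h3, h4, h5, h6⟩ =>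
      hno ⟨L, v, w, h1, h2, h3, h4, h5.trans (by omega), h6⟩) (List.Perm.refl _) hPc hP0 (by simp)
  have hl : n / 20 ≤ P.length := by
    have hsub : A₁ ⊆ P.toFinset := by
      intro v hv
      obtain ⟨L, hL, hLv⟩ := hA₁L v hv
      exact List.mem_toFinset.2 (hL.perm.mem_iff.1 (List.mem_of_head? hLv))
    have h1 := (Finset.card_le_card hsub).trans (List.toFinset_card_le P)
    exact hA₁.trans (by exact_mod_cast h1)
  have hln : (P.length : ℝ) ≤ n := by
    refine le_trans ?_ hn
    exact_mod_cast hP.length_le_card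
  obtain ⟨s, k, hml, hlm, hs12, hks, hsk, hns, hsn⟩ := exists_segment_length hT hl hln hn9
  have hs0 : (0 : ℝ) < s := by exact_mod_cast (by omega : 0 < s)
  have hps : 625000 * T * lam ≤ p * s := by
    have h1 := hr.trans (mul_le_mul_of_nonneg_left hns hp.le)
    have h2 : (1600 * T) * (625000 * T * lam) ≤ (1600 * T) * (p * s) := by linarith
    exact le_of_mul_le_mul_left h2 (by positivity)
  have hgrow₂ : n ≤ ((p * s / 4) ^ 2 / (20 * lam ^ 2)) ^ T := by
    refine hnT.trans (pow_le_pow_left₀ (by positivity) ?_ T)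
    rw [div_le_div_iff₀ hlam0 (by positivity)]
    have h1 : (625000 * T * lam) * (p * s) ≤ (p * s) * (p * s) :=
      mul_le_mul_of_nonneg_right hps (by positivity)
    have h2 : p * n * lam ≤ p * (1600 * T * s) * lam :=
      mul_le_mul_of_nonneg_right (mul_le_mul_of_nonneg_left hns hp.le) hlam0.le
    have h3 : 320 * (p * n * lam) ≤ (p * s) * (p * s) := by
      have : 0 ≤ T * lam * (p * s) := by positivity
      linarith
    have h4 := mul_le_mul_of_nonneg_right h3 hlam0.le
    linarith
  obtain ⟨a₀, -⟩ := List.exists_mem_of_ne_nil P hP0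
  set f : ℕ → V := fun i => P.getD i a₀ with hf
  have hfget : ∀ i (hi : i < P.length), f i = P[i] := fun i hi => by
    simp [hf, List.getD_eq_getElem?_getD, List.getElem?_eq_getElem hi]
  have hinj : Set.InjOn f (Set.Iio P.length) := by
    intro i hi j hj hij
    rw [Set.mem_Iio] at hi hj
    rw [hfget i hi, hfget j hj] at hij
    exact (hP.getElem_inj_iff).1 hij
  have hfedge : ∀ i, i + 1 < P.length → s(f i, f (i + 1)) ∈ pathEdges P :=
    fun i hi => getD_mem_pathEdges a₀ hi
  have hjl : ∀ j < 20 * T, j * (s + 2) + (s + 2) ≤ P.length := by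
    intro j hj
    have := Nat.mul_le_mul_right (s + 2) hj
    rw [Nat.succ_mul] at this
    omega
  obtain ⟨Y, hYk, hY⟩ := hmix.exists_exceptional (m := 20 * T) (s := s) (k := k) hp (pathNbrs P)
    (card_pathNbrs_le hP)
    (fun j => (Finset.range s).image (fun i => f (j * (s + 2) + i + 1))) (by omega)
    (fun j hj => by
      have := hjl j hj
      rw [Finset.card_image_of_injOn, Finset.card_range]
      intro x hx y hy hxy
      simp only [Finset.coe_range, Set.mem_Iio] at hx hy
      have := hinj (by simp only [Set.mem_Iio]; omega) (by simp only [Set.mem_Iio]; omega) hxy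
      omega) hks (by
      have hsk' : (s : ℝ) ≤ 12 * k := by exact_mod_cast hsk
      have h1 : (625000 * T * lam) * (625000 * T * lam) ≤ (p * s) * (p * s) :=
        mul_self_le_mul_self (by positivity) hps
      have h2 : (p ^ 2 * s) * s ≤ (p ^ 2 * s) * (12 * k) :=
        mul_le_mul_of_nonneg_left hsk' (by positivity)
      have h3 : (T : ℝ) * lam ^ 2 ≤ T ^ 2 * lam ^ 2 :=
        mul_le_mul_of_nonneg_right (by nlinarith) (by positivity)
      have h4 : 0 < (T : ℝ) * lam ^ 2 := by positivity
      push_cast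
      linarith)
  have hYlt : (Y.card : ℝ) < n / 20 := by
    have h1 : ((6 * Y.card : ℕ) : ℝ) ≤ s := by exact_mod_cast (by omega : 6 * Y.card ≤ s)
    push_cast at h1
    linarith
  have havoid : ∀ A : Finset V, n / 20 ≤ A.card → ∃ v ∈ A, v ∉ Y := fun A hA =>
    Finset.exists_mem_notMem_of_card_lt_card (by exact_mod_cast hYlt.trans_le hA)
  obtain ⟨v, hvA, hvY⟩ := havoid A₁ hA₁
  obtain ⟨L₁, hL₁, hL₁v⟩ := hA₁L v hvA
  have hL₁0 : L₁ ≠ [] := by rintro rfl; simp at hL₁v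
  have hL₁P : L₁.reverse.Perm P := (List.reverse_perm _).trans hL₁.perm
  obtain ⟨A₂, hA₂, hA₂L⟩ := exists_reroute_of_not_isClosable (c := 2 * T) (T := T) (Q := L₁.reverse)
    hmix hp hlam0 hn0 hmin' hgrow₁ hP (fun ⟨L, v, w, h1, h2, h3, h4, h5, h6⟩ =>
      hno ⟨L, v, w, h1, h2, h3, h4, h5.trans (by omega), h6⟩) hL₁P
    (isChain_reverse_iff.2 hL₁.chain) (by simpa using hL₁0)
    (by rw [pathEdges_reverse]; exact hL₁.card_le)
  obtain ⟨w, hwA, hwY⟩ := havoid A₂ hA₂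
  obtain ⟨R, hR, hRw⟩ := hA₂L w hwA
  have hRP : R.Perm P := hR.perm.trans hL₁P
  have hRv : R.getLast? = some v := by rw [hR.last, List.getLast?_reverse, hL₁v]
  have hRsymm : (symmDiff (pathEdges P) (pathEdges R)).card ≤ 4 * T := by
    have h1 := hR.card_le
    rw [pathEdges_reverse] at h1
    have := card_symmDiff_le_add (pathEdges P) (pathEdges L₁) (pathEdges R)
    have := hL₁.card_le
    omega
  -- cut the path into two halves
  have hRnd : R.Nodup := hRP.nodup_iff.2 hP
  have hRlen : R.length = P.length := hRP.length_eq
  have hPlen : 2 ≤ P.length := by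
    have : 1 * 1 ≤ 20 * T * (s + 2) := Nat.mul_le_mul (by omega) (by omega)
    have : 20 * T ≤ 20 * T * (s + 2) := Nat.le_mul_of_pos_right _ (by omega)
    omega
  obtain ⟨Q₁, Q₂, rfl, hQ₁len⟩ : ∃ Q₁ Q₂, R = Q₁ ++ Q₂ ∧ Q₁.length = P.length / 2 :=
    ⟨R.take (P.length / 2), R.drop (P.length / 2), (List.take_append_drop _ _).symm, by
      rw [List.length_take]; omega⟩
  rw [List.length_append] at hRlen
  have hQ₁0 : Q₁ ≠ [] := by rintro rfl; simp at hQ₁len; omega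
  have hQ₂0 : Q₂ ≠ [] := by rintro rfl; simp at hRlen; omega
  obtain ⟨x, hx⟩ : ∃ x, Q₁.getLast? = some x := ⟨_, List.getLast?_eq_some_getLast hQ₁0⟩
  obtain ⟨y, hy⟩ : ∃ y, Q₂.head? = some y := ⟨_, List.head?_eq_some_head hQ₂0⟩
  have hE := pathEdges_append hx hy
  set M := insert s(x, y) (symmDiff (pathEdges P) (pathEdges (Q₁ ++ Q₂))) with hM
  have hMcard : M.card ≤ 4 * T + 1 := (Finset.card_insert_le _ _).trans (by omega)
  have hcover : ∀ i, i + 1 < P.length → s(f i, f (i + 1)) ∈ pathEdges Q₁ ∨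
      s(f i, f (i + 1)) ∈ pathEdges Q₂ ∨ s(f i, f (i + 1)) ∈ M := by
    intro i hi
    have h1 := hfedge i hi
    simp only [hM, hE, Finset.mem_insert, Finset.mem_symmDiff, Finset.mem_union]
    tauto
  have hmem : ∀ (Q : List V) (x y : V), s(x, y) ∈ pathEdges Q → x ∈ Q.toFinset ∧ y ∈ Q.toFinset :=
    fun Q x y h => by simpa using mem_of_mem_pathEdges h
  have hdisj : Disjoint Q₁.toFinset Q₂.toFinset :=
    List.disjoint_toFinset_iff_disjoint.2 (List.disjoint_of_nodup_append hRnd)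
  obtain ⟨j₁, hj₁, hseg₁⟩ := exists_intact_segment hinj hml hdisj (hmem Q₁) (hmem Q₂) hcover hMcard
    (by have := List.toFinset_card_le Q₂; omega)
  obtain ⟨j₂, hj₂, hseg₂⟩ := exists_intact_segment hinj hml hdisj.symm (hmem Q₂) (hmem Q₁)
    (fun i hi => by have := hcover i hi; tauto) hMcard
    (by have := List.toFinset_card_le Q₁; omega)
  have hchain := hR.chain
  rw [List.isChain_append] at hchain
  -- rotate the two halves independently
  obtain ⟨B₁, hB₁, hB₁L⟩ := hmix.exists_endpoints_of_segment (Q := Q₁) (a := w) hp hlam0 (by omega)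
    (by linarith) hgrow₂ hRnd.of_append_left hchain.1
    (by rwa [List.head?_append_of_ne_nil _ hQ₁0] at hRw) hwY hinj hfedge rfl (hjl j₁ hj₁) hseg₁
    (fun u hu => hY u hu j₁ hj₁)
  obtain ⟨B₂, hB₂, hB₂L⟩ := hmix.exists_endpoints_of_segment (Q := Q₂.reverse) (a := v) hp hlam0
    (by omega) (by linarith) hgrow₂ (List.nodup_reverse.2 hRnd.of_append_right)
    (isChain_reverse_iff.2 hchain.2.1)
    (by rwa [List.getLast?_append_of_ne_nil _ hQ₂0, ← List.head?_reverse] at hRv) hvY hinj hfedge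
    rfl (hjl j₂ hj₂) (by rw [pathEdges_reverse]; exact hseg₂) (fun u hu => hY u hu j₂ hj₂)
  obtain ⟨a, ha, b, hb, hab⟩ := hmix.exists_adj hp B₁ B₂ (by
    have h1 : (s : ℝ) / 40 * (s / 40) ≤ B₁.card * B₂.card :=
      mul_le_mul hB₁ hB₂ (by positivity) (by positivity)
    have h2 := mul_le_mul_of_nonneg_left h1 (by positivity : 0 ≤ p ^ 2)
    have h3 : lam * 625000 ≤ p * s := by
      have := mul_le_mul_of_nonneg_right hTR hlam0.le
      linarith
    have h4 : (lam * 625000) * (lam * 625000) ≤ (p * s) * (p * s) :=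
      mul_self_le_mul_self (by positivity) h3
    have h5 : 0 < lam ^ 2 := by positivity
    linarith)
  obtain ⟨L, hL, hLa⟩ := hB₁L a ha
  obtain ⟨N, hN, hNb⟩ := hB₂L b hb
  obtain ⟨h1, h2, h3⟩ := Reroutes.glue hR.chain hQ₁0 hQ₂0 hL hN
  have hL0 : L ≠ [] := by rintro rfl; simp at hLa
  have hN0 : N ≠ [] := by rintro rfl; simp at hNb
  refine hno ⟨L ++ N.reverse, a, b, h1.trans hRP, h2, ?_, ?_, ?_, Or.inl hab⟩
  · rwa [List.head?_append_of_ne_nil _ hL0]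
  · rwa [List.getLast?_append_of_ne_nil _ (by simpa using hN0), List.getLast?_reverse]
  · exact (card_symmDiff_le_add _ _ _).trans ((add_le_add hRsymm h3).trans (by omega))

end Closing

section Walks

variable {V : Type*} [DecidableEq V]

lemma pathEdges_support {G : SimpleGraph V} {u v : V} :
    ∀ p : G.Walk u v, pathEdges p.support = p.edges.toFinset
  | .nil => by simp [pathEdges]
  | .cons h .nil => by simp [pathEdges]
  | .cons h (.cons h' p) => by
    have := pathEdges_support (Walk.cons h' p)
    simp only [Walk.support_cons, Walk.edges_cons, List.toFinset_cons, pathEdges] at this ⊢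
    rw [← this]

lemma exists_walk_support_eq {α : Type*} {G : SimpleGraph α} {L : List α} {v w : α}
    (hL : L.IsChain G.Adj) (hv : L.head? = some v) (hw : L.getLast? = some w) :
    ∃ q : G.Walk v w, q.support = L := by
  have hne : L ≠ [] := by rintro rfl; simp at hv
  have hv' : L.head hne = v := by
    rw [List.head?_eq_some_head hne] at hv
    exact Option.some.inj hv
  have hw' : L.getLast hne = w := by
    rw [List.getLast?_eq_some_getLast hne] at hw
    exact Option.some.inj hw
  subst hv' hw'
  exact ⟨Walk.ofSupport L hne hL, Walk.support_ofSupport hne hL⟩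

end Walks

section Degrees

variable {n : ℕ} (G : SimpleGraph (Fin n))

lemma degOf_eq_degIn (v : Fin n) : degOf G v = degIn G Finset.univ v := by
  classical
  unfold degOf degIn
  rw [← Set.ncard_coe_finset]
  congr 1
  ext w
  simp

lemma ePairs_eq_sum_degIn (U W : Finset (Fin n)) : ePairs G U W = ∑ v ∈ U, degIn G W v := by
  classical
  unfold ePairs degIn
  rw [← Finset.card_sigma, ← Set.ncard_coe_finset]
  refine Set.ncard_congr (fun z _ => ⟨z.1, z.2⟩) ?_ ?_ ?_
  · intro z hz
    simpa using hz
  · rintro ⟨a, b⟩ ⟨c, d⟩ _ _ h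
    simpa using h
  · rintro ⟨a, b⟩ h
    exact ⟨(a, b), by simpa using h, rfl⟩

lemma isMixing_of_ePairs {lamb : ℝ} (h : ∀ U W : Set (Fin n),
    |(ePairs G U W : ℝ) - avgDeg G / n * U.ncard * W.ncard| ≤
      lamb * √((U.ncard : ℝ) * W.ncard)) : IsMixing G (avgDeg G / n) lamb := by
  intro U W
  have := h U W
  rw [ePairs_eq_sum_degIn, Set.ncard_coe_finset, Set.ncard_coe_finset] at this
  exact_mod_cast this

lemma avgDeg_sub_le_degOf {lamb : ℝ} (h : (maxDeg G : ℝ) - minDeg G ≤ lamb) (v : Fin n) :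
    avgDeg G - lamb ≤ degOf G v := by
  have hn : (0 : ℝ) < n := by exact_mod_cast v.pos
  have h1 : avgDeg G ≤ maxDeg G := by
    unfold avgDeg
    rw [div_le_iff₀ hn]
    refine (Finset.sum_le_card_nsmul _ _ (maxDeg G : ℝ) fun w _ => ?_).trans ?_
    · exact_mod_cast le_csSup (Set.finite_range (degOf G)).bddAbove (Set.mem_range_self w)
    · simp [mul_comm]
  have h2 : (minDeg G : ℝ) ≤ degOf G v := by
    exact_mod_cast Nat.sInf_le (Set.mem_range_self v)
  linarith

end Degrees

lemma IsMixing.le_lam {V : Type*} {G : SimpleGraph V} {p lam : ℝ} (h : IsMixing G p lam) (v : V) :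
    p ≤ lam := by
  classical
  have := (abs_le.1 (h {v} {v})).1
  have h0 : degIn G {v} v = 0 := by
    unfold degIn
    rw [Finset.card_eq_zero, Finset.filter_eq_empty_iff]
    simp
  simp [h0] at this
  linarith

lemma IsMixing.half_le_lam {V : Type*} {G : SimpleGraph V} {p lam : ℝ} (h : IsMixing G p lam)
    {v w : V} (hvw : G.Adj v w) : 1 / 2 ≤ lam := by
  classical
  have h1 := h.le_lam v
  have h2 := (abs_le.1 (h {v} {w})).2
  have h3 : degIn G {w} v = 1 := by
    unfold degIn
    rw [Finset.filter_true_of_mem (by simpa using hvw), Finset.card_singleton]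
  simp [h3] at h2
  linarith

/-- A number of rounds after which growth by a factor `r` per round exceeds `n`. -/
lemma exists_rounds {n r : ℝ} (hn : 1 ≤ Real.log n) (hn0 : 0 < n) (hr : Real.exp 1 ≤ r)
    (hrn : r ≤ n) :
    ∃ T : ℕ, 1 ≤ T ∧ (T : ℝ) ≤ 2 * (Real.log n / Real.log r) ∧ (T : ℝ) ≤ 2 * Real.log n ∧
      n ≤ r ^ T := by
  have hr0 : 0 < r := (Real.exp_pos 1).trans_le hr
  have hlr : 1 ≤ Real.log r := (Real.le_log_iff_exp_le hr0).2 hr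
  have hle : Real.log r ≤ Real.log n := Real.log_le_log hr0 hrn
  have h1 : 1 ≤ Real.log n / Real.log r := (one_le_div (by linarith)).2 hle
  have h2 : Real.log n / Real.log r ≤ Real.log n := div_le_self (by linarith) hlr
  have h3 := Nat.ceil_lt_add_one (by linarith : 0 ≤ Real.log n / Real.log r)
  have h4 := Nat.le_ceil (Real.log n / Real.log r)
  refine ⟨⌈Real.log n / Real.log r⌉₊, ?_, by linarith, by linarith, ?_⟩
  · exact Nat.one_le_ceil_iff.2 (by linarith)
  · rw [div_le_iff₀ (by linarith)] at h4
    rw [← Real.log_le_log_iff hn0 (by positivity), Real.log_pow]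
    exact h4

/-- Rotation lemma, irregular case: under the pseudorandomness conditions, any path `P`
can be transformed, by at most `C log n / log(d/λ̄)` edge changes, into a path `P*` on the
same vertex set which either closes to a cycle or can be extended outside. -/
theorem path_rotation_irregular :
    ∃ C : ℝ, 0 < C ∧ ∃ K : ℝ, 0 < K ∧ ∃ n₀ : ℕ, ∀ n : ℕ, n₀ ≤ n →
    ∀ (G : SimpleGraph (Fin n)) (lamb : ℝ), 0 < lamb →
    (∀ U W : Set (Fin n),
      |(ePairs G U W : ℝ) - avgDeg G / n * U.ncard * W.ncard| ≤
        lamb * Real.sqrt ((U.ncard : ℝ) * W.ncard)) →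
    (maxDeg G : ℝ) - (minDeg G : ℝ) ≤ lamb →
    avgDeg G ≥ K * lamb * (Real.log n) ^ 2 →
    Real.log (avgDeg G) * Real.log (avgDeg G / lamb) ≥ K * Real.log n →
    ∀ (u v : Fin n) (p : G.Walk u v), p.IsPath →
      ∃ (a b : Fin n) (q : G.Walk a b), q.IsPath ∧
        (∀ x, x ∈ q.support ↔ x ∈ p.support) ∧
        ((symmDiff p.edges.toFinset q.edges.toFinset).card : ℝ) ≤
          C * Real.log n / Real.log (avgDeg G / lamb) ∧
        (G.Adj a b ∨ ∃ x y : Fin n, (x = a ∨ x = b) ∧ y ∉ q.support ∧ G.Adj x y) := by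
  refine ⟨16, by norm_num, 4 * 10 ^ 9, by norm_num, 3, ?_⟩
  intro n hn₀ G lamb hlamb hdisc hdiff hd _ u v p hpath
  have hn3 : (3 : ℝ) ≤ n := by exact_mod_cast hn₀
  have hn0 : (0 : ℝ) < n := by linarith
  have hlog : 1 ≤ Real.log n := by
    rw [Real.le_log_iff_exp_le hn0]
    exact (Real.exp_one_lt_d9.le.trans (by norm_num)).trans hn3
  have hmix := isMixing_of_ePairs G hdisc
  have hlog2 : 1 ≤ Real.log n ^ 2 := one_le_pow₀ hlog
  have hd9 : 4 * 10 ^ 9 * lamb ≤ avgDeg G := by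
    have := mul_le_mul_of_nonneg_left hlog2 (by positivity : 0 ≤ 4 * 10 ^ 9 * lamb)
    linarith
  have hd0 : 0 < avgDeg G := by linarith
  have hmin : ∀ w, avgDeg G - lamb ≤ degIn G Finset.univ w := fun w => by
    rw [← degOf_eq_degIn]
    exact avgDeg_sub_le_degOf G hdiff w
  have hlamb_half : 1 / 2 ≤ lamb := by
    classical
    have h1 : 0 < degIn G Finset.univ u := by
      have := hmin u
      have h2 : (0 : ℝ) < degIn G Finset.univ u := by linarith
      exact_mod_cast h2
    obtain ⟨w, hw⟩ := Finset.card_pos.1 h1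
    exact hmix.half_le_lam (Finset.mem_filter.1 hw).2
  have hpn : avgDeg G / n * n = avgDeg G := div_mul_cancel₀ _ hn0.ne'
  have hle := hmix.le_lam u
  have hrn : avgDeg G / lamb ≤ n := by
    rw [div_le_iff₀ hn0] at hle
    rw [div_le_iff₀ hlamb, mul_comm]
    exact hle
  obtain ⟨T, hT, hTr, hTn, hnT⟩ := exists_rounds hlog hn0 (r := avgDeg G / lamb)
    (by
      rw [le_div_iff₀ hlamb]
      have := Real.exp_one_lt_d9
      nlinarith) hrn
  have hTd : 10 ^ 9 * (T : ℝ) ^ 2 * lamb ≤ avgDeg G := by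
    have h1 := pow_le_pow_left₀ (Nat.cast_nonneg T) hTn 2
    have h2 := mul_le_mul_of_nonneg_left h1 hlamb.le
    linarith
  obtain ⟨L, a, b, hLP, hLc, ha, hb, hcard, hend⟩ := hmix.isClosable (n := n) (T := T)
    (by positivity) (by simp) hlamb_half hle (by rwa [hpn]) hT (by rwa [hpn]) (by rwa [hpn])
    hpath.support_nodup p.isChain_adj_support p.support_ne_nil
  obtain ⟨q, rfl⟩ := exists_walk_support_eq hLc ha hb
  refine ⟨a, b, q, Walk.IsPath.mk' (hLP.nodup_iff.2 hpath.support_nodup), fun x => hLP.mem_iff, ?_,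
    hend⟩
  rw [pathEdges_support, pathEdges_support] at hcard
  have hcard' : ((symmDiff p.edges.toFinset q.edges.toFinset).card : ℝ) ≤ (8 * T : ℕ) := by
    exact_mod_cast hcard
  push_cast at hcard'
  rw [mul_div_assoc]
  linarith
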